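/- arXiv:math/0410300 — 2 statements merged into one kernel-verified Lean document; each statement's English description precedes it below -/
import Mathlib

section
/- Fix g ≥ 1 and let M = Λ*(V) ⊗_ℤ T with the operators U and D_γ (γ ∈ V) and the grading described below. If φ : M → M is an additive bijection that commutes with U, commutes with D_γ for every γ ∈ V, and preserves the grading (φ(M^{(d)}) = M^{(d)} for all d), then φ is multiplication by +1 or by −1. -/
noncomputable section

/-- Basis elements of `Λ*(R^{2g}) ⊗ T`: a subset `S ⊆ {1,…,2g}` (the wedge of the
corresponding basis vectors) and `j ∈ ℕ` (the factor `U^{-j}`). -/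
abbrev BIdx (g : ℕ) : Type := Finset (Fin (2 * g)) × ℕ

/-- The module `M = Λ*(V) ⊗ T`, with `V` free of rank `2g` over `R`,
modelled as finitely supported families of coefficients on the basis. -/
abbrev MM (R : Type) [CommRing R] (g : ℕ) : Type := BIdx g →₀ R

variable (R : Type) [CommRing R]

/-- The Koszul sign `(-1)^{#{a ∈ S | a < b}}` for inserting/removing `b` in `S`. -/
def sgnCoef {g : ℕ} (b : Fin (2 * g)) (S : Finset (Fin (2 * g))) : R :=
  (-1) ^ (S.filter fun a => a < b).card

/-- The standard symplectic form on the basis: `ω(e_i, f_i) = 1 = -ω(f_i, e_i)`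
(with `e_i` the first `g` basis vectors and `f_i` the last `g`). -/
def omg {g : ℕ} (a b : Fin (2 * g)) : R :=
  if a.1 < g ∧ b.1 = a.1 + g then 1 else if b.1 < g ∧ a.1 = b.1 + g then -1 else 0

/-- The `U`-action on `M = Λ*(V) ⊗ T`, acting on the second factor. -/
def Uop (g : ℕ) : AddMonoid.End (MM R g) :=
  Finsupp.liftAddHom fun p =>
    if p.2 = 0 then 0 else Finsupp.singleAddHom (p.1, p.2 - 1)

/-- The operator `D_γ(x ⊗ t) = ι_{ω(γ,·)}(x) ⊗ t + (γ ∧ x) ⊗ U·t` for `γ ∈ V`. -/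
def Dop (g : ℕ) (γ : Fin (2 * g) → R) : AddMonoid.End (MM R g) :=
  Finsupp.liftAddHom fun p =>
    (∑ b ∈ p.1,
      (Finsupp.singleAddHom (p.1.erase b, p.2)).comp
        (AddMonoidHom.mulLeft (sgnCoef R b p.1 * ∑ a, γ a * omg R a b))) +
    (∑ b : Fin (2 * g),
      if b ∈ p.1 then 0
      else if p.2 = 0 then 0
      else (Finsupp.singleAddHom (insert b p.1, p.2 - 1)).comp
        (AddMonoidHom.mulLeft (γ b * sgnCoef R b p.1)))

/-- The homogeneous component `M^{(d)}`: the set of elements supported on basis elements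
`(S, j)` with `#S + 2j = d`. -/
def homogSet (g : ℕ) (d : ℕ) : Set (MM R g) :=
  {x | ∀ p ∈ x.support, p.1.card + 2 * p.2 = d}

lemma Uop_single (g : ℕ) (p : BIdx g) (a : R) :
    Uop R g (Finsupp.single p a) = if p.2 = 0 then 0 else Finsupp.single (p.1, p.2 - 1) a := by
  refine (Finsupp.liftAddHom_apply_single _ _ _).trans ?_
  split_ifs <;> rfl

lemma Uop_apply (g : ℕ) (y : MM R g) (S : Finset (Fin (2 * g))) (j : ℕ) :
    Uop R g y (S, j) = y (S, j + 1) := by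
  induction y using Finsupp.induction_linear with
  | zero => simp
  | add f h hf hh => simp [hf, hh]
  | single p a =>
    obtain ⟨T, k⟩ := p
    rw [Uop_single]
    cases k <;> simp [Finsupp.single_apply]

lemma Dop_single (g : ℕ) (γ : Fin (2 * g) → R) (p : BIdx g) (r : R) :
    Dop R g γ (Finsupp.single p r) =
      (∑ b ∈ p.1, Finsupp.single (p.1.erase b, p.2)
        ((sgnCoef R b p.1 * ∑ a, γ a * omg R a b) * r)) +
      ∑ b : Fin (2 * g), if b ∈ p.1 then 0 else if p.2 = 0 then 0
        else Finsupp.single (insert b p.1, p.2 - 1) (γ b * sgnCoef R b p.1 * r) := by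
  refine (Finsupp.liftAddHom_apply_single _ _ _).trans ?_
  rw [AddMonoidHom.add_apply, AddMonoidHom.finsetSum_apply,
    AddMonoidHom.finsetSum_apply]
  congr 1
  refine Finset.sum_congr rfl fun b _ => ?_
  split_ifs <;> rfl

/-- The standard symplectic form is unimodular. -/
lemma exists_sum_mul_omg_eq_ite (g : ℕ) (b : Fin (2 * g)) :
    ∃ γ : Fin (2 * g) → R, ∀ c, ∑ a, γ a * omg R a c = if c = b then 1 else 0 := by
  by_cases hb : b.1 < g
  · refine ⟨Pi.single ⟨b.1 + g, by omega⟩ (-1), fun c => ?_⟩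
    rw [Finset.sum_eq_single ⟨b.1 + g, by omega⟩ (fun a _ ha => by simp [ha]) (by simp)]
    have hc : (c.1 < g ∧ b.1 + g = c.1 + g) ↔ c = b := by
      rw [Fin.ext_iff]; omega
    simp only [Pi.single_eq_same, omg, hc]
    rw [if_neg (by omega)]
    split_ifs <;> simp
  · refine ⟨Pi.single ⟨b.1 - g, by omega⟩ 1, fun c => ?_⟩
    rw [Finset.sum_eq_single ⟨b.1 - g, by omega⟩ (fun a _ ha => by simp [ha]) (by simp)]
    have hc : (b.1 - g < g ∧ c.1 = b.1 - g + g) ↔ c = b := by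
      rw [Fin.ext_iff]; omega
    simp only [Pi.single_eq_same, omg, hc]
    rw [if_neg (c := c.1 < g ∧ _) (by omega)]
    split_ifs <;> simp

lemma Dop_apply_erase_zero (g : ℕ) (b : Fin (2 * g)) (γ : Fin (2 * g) → R)
    (hγ : ∀ c, ∑ a, γ a * omg R a c = if c = b then 1 else 0)
    (y : MM R g) (hy : Uop R g y = 0) (S : Finset (Fin (2 * g))) (hS : b ∈ S) :
    Dop R g γ y (S.erase b, 0) = sgnCoef R b S * y (S, 0) := by
  have hy' : ∀ p ∈ y.support, p.2 = 0 := by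
    rintro ⟨T, k⟩ hp
    rw [Finsupp.mem_support_iff] at hp
    cases k with
    | zero => rfl
    | succ k => exact absurd (by rw [← Uop_apply, hy]; rfl) hp
  conv_lhs => rw [← Finsupp.sum_single y]
  rw [Finsupp.sum, map_sum, Finsupp.finsetSum_apply]
  have key : ∀ p ∈ y.support, Dop R g γ (Finsupp.single p (y p)) (S.erase b, 0) =
      if p = (S, 0) then sgnCoef R b S * y (S, 0) else 0 := by
    rintro ⟨T, k⟩ hp
    obtain rfl : k = 0 := hy' _ hp
    rw [Dop_single]
    simp only [hγ, if_true, ite_self, Finset.sum_const_zero, add_zero, Finsupp.finsetSum_apply,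
      mul_ite, mul_one, mul_zero, ite_mul, zero_mul, Prod.mk.injEq, and_true]
    by_cases hT : b ∈ T
    · rw [Finset.sum_eq_single b (fun c _ hc => by simp [hc]) (fun h => absurd hT h)]
      have : T.erase b = S.erase b ↔ T = S :=
        ⟨fun h => by rw [← Finset.insert_erase hT, h, Finset.insert_erase hS], fun h => h ▸ rfl⟩
      rw [if_pos rfl, Finsupp.single_apply]
      simp only [Prod.mk.injEq, and_true, this]
      split_ifs with h
      · rw [h]
      · rfl
    · rw [if_neg (by rintro rfl; exact hT hS)]
      refine Finset.sum_eq_zero fun c hc => ?_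
      rw [if_neg (by rintro rfl; exact hT hc)]
      simp
  rw [Finset.sum_congr rfl key, Finset.sum_ite_eq']
  split_ifs with h
  · rfl
  · rw [Finsupp.notMem_support_iff.mp h, mul_zero]

/-- The elements killed by `U` and by all `D_γ` are the multiples of `1 ⊗ U^0`. -/
lemma apply_eq_zero_of_Uop_of_Dop (g : ℕ) (y : MM R g) (hU : Uop R g y = 0)
    (hD : ∀ γ, Dop R g γ y = 0) (p : BIdx g) (hp : p.1.card + 2 * p.2 ≠ 0) : y p = 0 := by
  obtain ⟨S, j⟩ := p
  cases j with
  | succ j => rw [← Uop_apply, hU]; rfl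
  | zero =>
    obtain ⟨b, hb⟩ : S.Nonempty := Finset.card_ne_zero.mp (by simpa using hp)
    obtain ⟨γ, hγ⟩ := exists_sum_mul_omg_eq_ite R g b
    have h := Dop_apply_erase_zero R g b γ hγ y hU S hb
    have hu : IsUnit (sgnCoef R b S) := (isUnit_one.neg).pow _
    rw [hD] at h
    exact (hu.mul_right_eq_zero).mp h.symm

/-- A degree-preserving additive map commuting with `U` and all `D_γ` that kills the degree `0`
part vanishes. -/
lemma eq_zero_of_commute_of_degree_zero (g : ℕ) (ψ : MM R g →+ MM R g)
    (hU : ∀ x, ψ (Uop R g x) = Uop R g (ψ x))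
    (hD : ∀ (γ : Fin (2 * g) → R) (x), ψ (Dop R g γ x) = Dop R g γ (ψ x))
    (hgr : ∀ d : ℕ, ∀ x ∈ homogSet R g d, ψ x ∈ homogSet R g d)
    (h0 : ∀ a, ψ (Finsupp.single (∅, 0) a) = 0) : ψ = 0 := by
  have key : ∀ (d : ℕ) (p : BIdx g) (a : R), p.1.card + 2 * p.2 = d →
      ψ (Finsupp.single p a) = 0 := by
    intro d
    induction d using Nat.strong_induction_on with
    | _ d ih =>
      rintro ⟨S, j⟩ a hd
      rcases Nat.eq_zero_or_pos d with rfl | hpos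
      · obtain ⟨hS, rfl⟩ : S.card = 0 ∧ j = 0 := by simp only at hd; omega
        rw [Finset.card_eq_zero.mp hS, h0]
      have hmem : ψ (Finsupp.single (S, j) a) ∈ homogSet R g d := by
        refine hgr d _ fun q hq => ?_
        rw [Finset.mem_singleton.mp (Finsupp.support_single_subset hq)]
        exact hd
      simp only at hd
      ext q
      by_contra hq
      have hqd := hmem q (Finsupp.mem_support_iff.mpr hq)
      refine hq (apply_eq_zero_of_Uop_of_Dop R g _ ?_ (fun γ => ?_) q (by omega))
      · rw [← hU, Uop_single]
        split_ifs with hj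
        · exact map_zero ψ
        · simp only at hj
          exact ih (d - 2) (by omega) _ _ (by simp only; omega)
      · rw [← hD, Dop_single, map_add, map_sum, map_sum, Finset.sum_eq_zero, Finset.sum_eq_zero,
          add_zero]
        · intro b _
          split_ifs with hb hj
          · exact map_zero ψ
          · exact map_zero ψ
          · simp only at hb hj
            exact ih (d - 1) (by omega) _ _
              (by simp only [Finset.card_insert_of_notMem hb]; omega)
        · intro b hb
          have hc := Finset.card_erase_add_one hb
          simp only at hc
          exact ih (d - 1) (by omega) _ _ (by simp only; omega)
  ext p a : 2
  exact key _ p a rfl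

lemma eq_single_of_mem_homogSet_zero (g : ℕ) {x : MM R g} (hx : x ∈ homogSet R g 0) :
    x = Finsupp.single (∅, 0) (x (∅, 0)) := by
  refine Finsupp.eq_single_iff.mpr ⟨fun q hq => ?_, rfl⟩
  have := hx q hq
  rw [Finset.mem_singleton, Prod.ext_iff]
  exact ⟨Finset.card_eq_zero.mp (by omega), by simp only; omega⟩

/-- Every additive bijection of `M = Λ*(ℤ^{2g}) ⊗ T` that commutes with `U`, commutes with
`D_γ` for every `γ`, and preserves the grading, is multiplication by `+1` or `−1`. -/
theorem stmt10 (g : ℕ) (hg : 1 ≤ g) (φ : MM ℤ g →+ MM ℤ g)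
    (hbij : Function.Bijective φ)
    (hU : ∀ x, φ (Uop ℤ g x) = Uop ℤ g (φ x))
    (hD : ∀ (γ : Fin (2 * g) → ℤ) (x), φ (Dop ℤ g γ x) = Dop ℤ g γ (φ x))
    (hgr : ∀ d : ℕ, φ '' homogSet ℤ g d = homogSet ℤ g d) :
    (∀ x, φ x = x) ∨ (∀ x, φ x = -x) := by
  have hgr' : ∀ d, ∀ x ∈ homogSet ℤ g d, φ x ∈ homogSet ℤ g d := fun d x hx =>
    hgr d ▸ Set.mem_image_of_mem φ hx
  have h1 : (Finsupp.single (∅, 0) 1 : MM ℤ g) ∈ homogSet ℤ g 0 := fun q hq => by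
    rw [Finset.mem_singleton.mp (Finsupp.support_single_subset hq)]
    rfl
  obtain ⟨c, hc⟩ : ∃ c : ℤ, φ (Finsupp.single (∅, 0) 1) = Finsupp.single (∅, 0) c :=
    ⟨_, eq_single_of_mem_homogSet_zero ℤ g (hgr' 0 _ h1)⟩
  have hca : ∀ a : ℤ, φ (Finsupp.single (∅, 0) a) = Finsupp.single (∅, 0) (c * a) := fun a => by
    have : (Finsupp.single (∅, 0) a : MM ℤ g) = a • Finsupp.single (∅, 0) 1 := by simp
    rw [this, map_zsmul, hc, Finsupp.smul_single, smul_eq_mul, mul_comm a]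
  have hunit : IsUnit c := by
    obtain ⟨x, hx, hx1⟩ : Finsupp.single (∅, 0) 1 ∈ φ '' homogSet ℤ g 0 := (hgr 0).symm ▸ h1
    rw [eq_single_of_mem_homogSet_zero ℤ g hx, hca] at hx1
    exact IsUnit.of_mul_eq_one _ (Finsupp.single_injective _ hx1)
  have hφ : ∀ x, φ x = c • x := by
    have h := eq_zero_of_commute_of_degree_zero ℤ g (φ - c • AddMonoidHom.id _)
      (fun x => by simp [hU]) (fun γ x => by simp [hD])
      (fun d x hx q hq => by
        by_contra hne
        have h2 : φ x q = 0 := by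
          by_contra h
          exact hne (hgr' d x hx q (Finsupp.mem_support_iff.mpr h))
        have h3 : x q = 0 := by
          by_contra h
          exact hne (hx q (Finsupp.mem_support_iff.mpr h))
        exact Finsupp.mem_support_iff.mp hq (by simp [h2, h3]))
      (fun a => by simp [hca])
    exact fun x => sub_eq_zero.mp (DFunLike.congr_fun h x)
  rcases Int.isUnit_iff.mp hunit with rfl | rfl
  · exact Or.inl fun x => by simp [hφ]
  · exact Or.inr fun x => by simp [hφ]
end
end

section
/- For the complex C of the torus knot T_{3,4} defined below, let X⁺(1) be the mapping cone of the chain map D⁺₁ : ⊕_{s∈ℤ} A⁺_s → ⊕_{s∈ℤ} B⁺_s (one copy B⁺_s of B⁺ for each s ∈ ℤ) given by D⁺₁({a_s}) = {b_s} with b_s = v⁺_s(a_s) + h⁺_{s−1}(a_{s−1}). Then the homology of X⁺(1) is isomorphic, as a ℤ[U]-module, to T ⊕ (ℤ[U]/U)⁴. (This computes HF⁺ of +1-surgery on T_{3,4}, i.e. of −Σ(3,4,11).) -/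
noncomputable section

/-- Basis elements `y_{l,m}` of the knot Floer complex `C` of the torus knot `T_{3,4}`:
`l ∈ {1,…,5}` (as `Fin 5`, zero-indexed) and `m ∈ ℤ` (the power of `U`). -/
abbrev CBase : Type := Fin 5 × ℤ

/-- The complex `C` (as a `ℤ[U]`-module): the free abelian group on the basis `y_{l,m}`. -/
abbrev Cm : Type := CBase →₀ ℤ

/-- The Alexander offsets `(j₁,…,j₅) = (3,2,0,−2,−3)`;
`y_{l,m}` has filtration level `(−m, −m + j_l)`. -/
def jval : Fin 5 → ℤ := ![3, 2, 0, -2, -3]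

/-- The `U`-action on `C`: `U·y_{l,m} = y_{l,m+1}`. -/
def UC : AddMonoid.End Cm :=
  Finsupp.liftAddHom fun p => Finsupp.singleAddHom (p.1, p.2 + 1)

/-- Multiplication by `U^s` (for any `s ∈ ℤ`): `y_{l,m} ↦ y_{l,m+s}`. -/
def shiftC (s : ℤ) : AddMonoid.End Cm :=
  Finsupp.liftAddHom fun p => Finsupp.singleAddHom (p.1, p.2 + s)

/-- The chain isomorphism `C{j ≥ 0} → C{i ≥ 0}` (extended to all of `C`), induced by
`y_{l,m} ↦ y_{6−l, m−j_l}`. -/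
def flipC : AddMonoid.End Cm :=
  Finsupp.liftAddHom fun p => Finsupp.singleAddHom (4 - p.1, p.2 - jval p.1)

/-- The differential on `C`: `∂y_{2,m} = y_{1,m+1} + y_{3,m}`, `∂y_{4,m} = y_{3,m+2} + y_{5,m}`,
and `∂y_{l,m} = 0` for `l ∈ {1,3,5}`. -/
def dC : AddMonoid.End Cm :=
  Finsupp.liftAddHom fun p =>
    if p.1 = (1 : Fin 5) then
      Finsupp.singleAddHom ((0 : Fin 5), p.2 + 1) + Finsupp.singleAddHom ((2 : Fin 5), p.2)
    else if p.1 = (3 : Fin 5) then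
      Finsupp.singleAddHom ((2 : Fin 5), p.2 + 2) + Finsupp.singleAddHom ((4 : Fin 5), p.2)
    else 0

/-- For a set `S` of filtration levels closed under increase, the quotient complex `C{S}` is
spanned by the generators whose filtration level lies in `S`; we model it as finitely
supported functions on the corresponding set of basis elements. -/
abbrev SubC (q : CBase → Prop) : Type := {p : CBase // q p} →₀ ℤ

/-- The inclusion of `C{S}` into `C` (as groups). -/
def inclS (q : CBase → Prop) : SubC q →+ Cm :=
  Finsupp.liftAddHom fun p => Finsupp.singleAddHom p.1

/-- The projection of `C` onto `C{S}`, killing all other generators. -/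
def projS (q : CBase → Prop) [DecidablePred q] : Cm →+ SubC q :=
  Finsupp.liftAddHom fun p =>
    if h : q p then Finsupp.singleAddHom (⟨p, h⟩ : {p : CBase // q p}) else 0

/-- The endomorphism of `C{S}` induced by an endomorphism of `C` (project after applying). -/
def endS (q : CBase → Prop) [DecidablePred q] (φ : AddMonoid.End Cm) :
    AddMonoid.End (SubC q) :=
  (projS q).comp (φ.comp (inclS q))

/-- The basis elements of `B⁺ = C{i ≥ 0}`: those `y_{l,m}` with `−m ≥ 0`. -/
def condB : CBase → Prop := fun p => p.2 ≤ 0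

instance : DecidablePred condB := fun p => inferInstanceAs (Decidable (p.2 ≤ 0))

/-- The basis elements of `A⁺_s = C{max(i, j−s) ≥ 0}`: those `y_{l,m}` with
`−m ≥ 0` or `−m + j_l − s ≥ 0`. -/
def condA (s : ℤ) : CBase → Prop := fun p => p.2 ≤ 0 ∨ p.2 ≤ jval p.1 - s

instance (s : ℤ) : DecidablePred (condA s) := fun p => instDecidableOr

/-- The basis elements of `C{j ≥ s}`: those `y_{l,m}` with `−m + j_l − s ≥ 0`. -/
def condJ (s : ℤ) : CBase → Prop := fun p => p.2 ≤ jval p.1 - s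

instance (s : ℤ) : DecidablePred (condJ s) := fun p => inferInstanceAs (Decidable (p.2 ≤ jval p.1 - s))

/-- `B⁺ = C{i ≥ 0}`. -/
abbrev Bm : Type := SubC condB

/-- `A⁺_s = C{max(i, j−s) ≥ 0}`. -/
abbrev Am (s : ℤ) : Type := SubC (condA s)

/-- The differential on `B⁺`. -/
def dB : AddMonoid.End Bm := endS condB dC

/-- The differential on `A⁺_s`. -/
def dA (s : ℤ) : AddMonoid.End (Am s) := endS (condA s) dC

/-- The `U`-action on `B⁺`. -/
def UB : AddMonoid.End Bm := endS condB UC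

/-- The `U`-action on `A⁺_s`. -/
def UA (s : ℤ) : AddMonoid.End (Am s) := endS (condA s) UC

/-- The projection `v⁺_s : A⁺_s → B⁺`. -/
def vMap (s : ℤ) : Am s →+ Bm := (projS condB).comp (inclS (condA s))

/-- Killing the generators of `C` whose `j`-filtration is `< s`. -/
def killJ (s : ℤ) : AddMonoid.End Cm := (inclS (condJ s)).comp (projS (condJ s))

/-- The map `h⁺_s : A⁺_s → B⁺`: project `A⁺_s → C{j ≥ s}`, multiply by `U^s` to reach
`C{j ≥ 0}`, then apply the chain isomorphism `C{j ≥ 0} → C{i ≥ 0}`. -/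
def hMap (s : ℤ) : Am s →+ Bm :=
  (projS condB).comp (flipC.comp ((shiftC s).comp ((killJ s).comp (inclS (condA s)))))

/-- The `ℤ[U]`-module `T = ℤ[U,U⁻¹]/(U·ℤ[U])`, modelled as `ℕ →₀ ℤ` where the value at `j`
is the coefficient of `U^{-j}`. -/
abbrev TT : Type := ℕ →₀ ℤ

/-- The `U`-action on `T`. -/
def UT : AddMonoid.End TT :=
  Finsupp.liftAddHom fun j => if j = 0 then 0 else Finsupp.singleAddHom (j - 1)

/-- The cycles of a differential `d`. -/
def cyc {M : Type*} [AddCommGroup M] (d : AddMonoid.End M) : AddSubgroup M :=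
  AddMonoidHom.ker d

/-- The homology of a complex `(M, d)`: cycles modulo boundaries. -/
def Hq {M : Type*} [AddCommGroup M] (d : AddMonoid.End M) : Type _ :=
  cyc d ⧸ ((AddMonoidHom.range d).addSubgroupOf (cyc d))

instance {M : Type*} [AddCommGroup M] (d : AddMonoid.End M) : AddCommGroup (Hq d) := by
  unfold Hq; infer_instance

/-- The homology class of a cycle. -/
def hcl {M : Type*} [AddCommGroup M] (d : AddMonoid.End M) (x : M) (hx : x ∈ cyc d) : Hq d :=
  QuotientAddGroup.mk (⟨x, hx⟩ : cyc d)

/-- The Maslov gradings of the generators `x₁,…,x₅`: `(0,−1,−2,−5,−6)`;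
`y_{l,m} = U^m·x_l` has degree `gr_l − 2m`. -/
def grval : Fin 5 → ℤ := ![0, -1, -2, -5, -6]

/-- The sign operator `a ↦ (−1)^{deg a}·a` on `A⁺_s`, negating the generators of odd degree;
it implements the sign `(−1)^{deg a}` in the mapping cone differential. -/
def sgnA (s : ℤ) : AddMonoid.End (Am s) :=
  Finsupp.liftAddHom fun p =>
    (Finsupp.singleAddHom p).comp
      (AddMonoidHom.mulLeft (if Even (grval p.1.1 - 2 * p.1.2) then (1 : ℤ) else -1))

/-- `⊕_{s ∈ ℤ} A⁺_s`. -/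
abbrev AS : Type := Π₀ s : ℤ, Am s

/-- `⊕_{s ∈ ℤ} B⁺_s` (one copy of `B⁺` for each `s ∈ ℤ`). -/
abbrev BS : Type := Π₀ _ : ℤ, Bm

/-- The differential on `⊕_s A⁺_s`. -/
def dAS : AddMonoid.End AS :=
  DFinsupp.sumAddHom fun s => (DFinsupp.singleAddHom (fun t : ℤ => Am t) s).comp (dA s)

/-- The differential on `⊕_s B⁺_s`. -/
def dBS : AddMonoid.End BS :=
  DFinsupp.sumAddHom fun s => (DFinsupp.singleAddHom (fun _ : ℤ => Bm) s).comp dB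

/-- The `U`-action on `⊕_s A⁺_s`. -/
def UAS : AddMonoid.End AS :=
  DFinsupp.sumAddHom fun s => (DFinsupp.singleAddHom (fun t : ℤ => Am t) s).comp (UA s)

/-- The `U`-action on `⊕_s B⁺_s`. -/
def UBS : AddMonoid.End BS :=
  DFinsupp.sumAddHom fun s => (DFinsupp.singleAddHom (fun _ : ℤ => Bm) s).comp UB

/-- The sign operator on `⊕_s A⁺_s`. -/
def sgnAS : AddMonoid.End AS :=
  DFinsupp.sumAddHom fun s => (DFinsupp.singleAddHom (fun t : ℤ => Am t) s).comp (sgnA s)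

/-- The chain map `D⁺₁ : ⊕_s A⁺_s → ⊕_s B⁺_s`, `(D⁺₁ a)_s = v⁺_s(a_s) + h⁺_{s−1}(a_{s−1})`. -/
def Dp1 : AS →+ BS :=
  DFinsupp.sumAddHom fun s =>
    ((DFinsupp.singleAddHom (fun _ : ℤ => Bm) s).comp (vMap s)) +
    ((DFinsupp.singleAddHom (fun _ : ℤ => Bm) (s + 1)).comp (hMap s))

/-- The mapping cone `X⁺(1)` of `D⁺₁`, with underlying group `(⊕_s A⁺_s) × (⊕_s B⁺_s)`. -/
abbrev X1 : Type := AS × BS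

/-- The mapping-cone differential `(a, b) ↦ (∂a, ∂b + (−1)^{deg a}·D⁺₁(a))`, where the sign
`(−1)^{deg a}` is implemented by the sign operator negating odd-degree generators. -/
def dX1 : AddMonoid.End X1 :=
  AddMonoidHom.prod (dAS.comp (AddMonoidHom.fst AS BS))
    ((dBS.comp (AddMonoidHom.snd AS BS)) + (Dp1.comp (sgnAS.comp (AddMonoidHom.fst AS BS))))

/-- The `U`-action on the mapping cone. -/
def UX1 : AddMonoid.End X1 :=
  AddMonoidHom.prod (UAS.comp (AddMonoidHom.fst AS BS)) (UBS.comp (AddMonoidHom.snd AS BS))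

/-- The `ℤ[U]`-module `T ⊕ (ℤ[U]/U)⁴`, with `U` acting as `U` on `T` and as `0` on `(ℤ[U]/U)⁴ ≅ ℤ⁴`. -/
abbrev W4 : Type := TT × (Fin 4 → ℤ)

/-- The `U`-action on `T ⊕ (ℤ[U]/U)⁴`. -/
def UW4 : AddMonoid.End W4 :=
  AddMonoidHom.prod (UT.comp (AddMonoidHom.fst TT (Fin 4 → ℤ))) 0

section Combinatorial

@[simp] lemma dC_single (p : CBase) (c : ℤ) : dC (Finsupp.single p c) =
    ![0, Finsupp.single (0, p.2 + 1) c + Finsupp.single (2, p.2) c, 0,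
      Finsupp.single (2, p.2 + 2) c + Finsupp.single (4, p.2) c, 0] p.1 := by
  refine (Finsupp.liftAddHom_apply_single _ p c).trans ?_
  obtain ⟨l, m⟩ := p
  fin_cases l <;> simp

@[simp] lemma UC_single (p : CBase) (c : ℤ) :
    UC (Finsupp.single p c) = Finsupp.single (p.1, p.2 + 1) c :=
  Finsupp.liftAddHom_apply_single _ p c

@[simp] lemma shiftC_single (s : ℤ) (p : CBase) (c : ℤ) :
    shiftC s (Finsupp.single p c) = Finsupp.single (p.1, p.2 + s) c :=
  Finsupp.liftAddHom_apply_single _ p c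

@[simp] lemma flipC_single (p : CBase) (c : ℤ) :
    flipC (Finsupp.single p c) = Finsupp.single (4 - p.1, p.2 - jval p.1) c :=
  Finsupp.liftAddHom_apply_single _ p c

@[simp] lemma inclS_single (q : CBase → Prop) (p : {p : CBase // q p}) (c : ℤ) :
    inclS q (Finsupp.single p c) = Finsupp.single p.1 c := by
  simp [inclS]

lemma projS_single_of_pos {q : CBase → Prop} [DecidablePred q] {p : CBase} (h : q p) (c : ℤ) :
    projS q (Finsupp.single p c) = Finsupp.single ⟨p, h⟩ c := by
  simp [projS, h]

lemma projS_single_of_neg {q : CBase → Prop} [DecidablePred q] {p : CBase} (h : ¬ q p) (c : ℤ) :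
    projS q (Finsupp.single p c) = 0 := by
  simp [projS, h]

lemma endS_apply (q : CBase → Prop) [DecidablePred q] (φ : AddMonoid.End Cm) (x : SubC q) :
    endS q φ x = projS q (φ (inclS q x)) := rfl

lemma hom_inclS_projS {G : Type*} [AddCommGroup G] (q : CBase → Prop) [DecidablePred q]
    (f : Cm →+ G) (hf : ∀ p c, ¬ q p → f (Finsupp.single p c) = 0) (x : Cm) :
    f (inclS q (projS q x)) = f x := by
  induction x using Finsupp.induction_linear with
  | zero => simp
  | add f g hf hg => simp [hf, hg]
  | single p c =>
    by_cases h : q p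
    · simp [projS_single_of_pos h]
    · simp [projS_single_of_neg h, hf p c h]

lemma inclS_apply (q : CBase → Prop) (x : SubC q) (p : {p : CBase // q p}) :
    inclS q x p.1 = x p := by
  induction x using Finsupp.induction_linear with
  | zero => simp
  | add f g hf hg => simp [hf, hg]
  | single r c => simp [Finsupp.single_apply, Subtype.ext_iff]

lemma projS_apply (q : CBase → Prop) [DecidablePred q] (x : Cm) (p : {p : CBase // q p}) :
    projS q x p = x p.1 := by
  induction x using Finsupp.induction_linear with
  | zero => simp
  | add f g hf hg => simp [hf, hg]
  | single r c =>
    by_cases h : q r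
    · simp [projS_single_of_pos h, Finsupp.single_apply, Subtype.ext_iff]
    · have : r ≠ p.1 := fun e => h (e ▸ p.2)
      simp [projS_single_of_neg h, this]

@[simp] lemma jval_zero : jval 0 = 3 := rfl
@[simp] lemma jval_one : jval 1 = 2 := rfl
@[simp] lemma jval_two : jval 2 = 0 := rfl
@[simp] lemma jval_three : jval 3 = -2 := rfl
@[simp] lemma jval_four : jval 4 = -3 := rfl

lemma condA_three (p : CBase) : condB p ↔ condA 3 p := by
  obtain ⟨l, m⟩ := p
  fin_cases l <;> simp [condA, condB] <;> omega

lemma endS_dC_projS (q : CBase → Prop) [DecidablePred q] (s : ℤ) (hq : ∀ p, q p ↔ condA s p)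
    (x : Cm) : endS q dC (projS q x) = projS q (dC x) := by
  refine hom_inclS_projS q ((projS q).comp dC) ?_ x
  rintro ⟨l, m⟩ c h
  rw [hq] at h
  change projS q (dC (Finsupp.single _ _)) = 0
  fin_cases l <;> simp [condA] at h ⊢ <;>
  (rw [projS_single_of_neg, projS_single_of_neg, add_zero] <;> simp [hq, condA] <;> omega)

/-- The chain map from `C` to `ℤ[U, U⁻¹]` (with basis `U^n`, `n ∈ ℤ`) computing the homology. -/
def psiC : Cm →+ (ℤ →₀ ℤ) :=
  Finsupp.liftAddHom fun p =>
    ![Finsupp.singleAddHom p.2, 0, -(Finsupp.singleAddHom (p.2 + 1) : ℤ →+ (ℤ →₀ ℤ)), 0,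
      Finsupp.singleAddHom (p.2 + 3)] p.1

@[simp] lemma psiC_single (p : CBase) (c : ℤ) : psiC (Finsupp.single p c) =
    ![Finsupp.single p.2 c, 0, -Finsupp.single (p.2 + 1) c, 0,
      Finsupp.single (p.2 + 3) c] p.1 := by
  refine (Finsupp.liftAddHom_apply_single _ p c).trans ?_
  obtain ⟨l, m⟩ := p
  fin_cases l <;> simp

lemma psiC_dC (x : Cm) : psiC (dC x) = 0 := by
  induction x using Finsupp.induction_linear with
  | zero => simp
  | add f g hf hg => simp [hf, hg]
  | single p c =>
    obtain ⟨l, m⟩ := p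
    fin_cases l <;> simp [add_assoc]

lemma psiC_UC (x : Cm) (n : ℤ) : psiC (UC x) n = psiC x (n - 1) := by
  induction x using Finsupp.induction_linear with
  | zero => simp
  | add f g hf hg => simp [hf, hg]
  | single p c =>
    obtain ⟨l, m⟩ := p
    fin_cases l <;> simp [Finsupp.single_apply] <;> grind

lemma psiC_flipC_shiftC (s : ℤ) (x : Cm) (n : ℤ) :
    psiC (flipC (shiftC s x)) n = psiC x (n - s) := by
  induction x using Finsupp.induction_linear with
  | zero => simp
  | add f g hf hg => simp [hf, hg]
  | single p c =>
    obtain ⟨l, m⟩ := p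
    fin_cases l <;> simp [Finsupp.single_apply, show (4 : Fin 5) - 1 = 3 from rfl,
      show (4 : Fin 5) - 2 = 2 from rfl, show (4 : Fin 5) - 3 = 1 from rfl] <;> grind

/-- The exponent of the bottom of the tower `H_*(A⁺_s)`. -/
def towerV (s : ℤ) : ℤ :=
  if 3 ≤ s then 0 else if 0 ≤ s then 1 else if s = -1 then 2 else if s = -2 then 3 else -s

lemma psiC_inclS_projS (q : CBase → Prop) [DecidablePred q] (s : ℤ) (hq : ∀ p, q p ↔ condA s p)
    {n : ℤ} (hn : n ≤ towerV s) (x : Cm) : psiC (inclS q (projS q x)) n = psiC x n := by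
  refine hom_inclS_projS q ((Finsupp.applyAddHom n).comp psiC) ?_ x
  rintro ⟨l, m⟩ c h
  rw [hq] at h
  unfold towerV at hn
  fin_cases l <;> simp [condA, Finsupp.single_apply] at h ⊢ <;> intro e <;> exfalso <;>
    split_ifs at hn <;> omega

lemma cycle_apply_eq_zero (q : CBase → Prop) [DecidablePred q] (s : ℤ)
    (hq : ∀ p, q p ↔ condA s p) (x : SubC q) (hx : endS q dC x = 0) (m : ℤ) :
    (∀ h : q (1, m), x ⟨(1, m), h⟩ = 0) ∧ ∀ h : q (3, m), x ⟨(3, m), h⟩ = 0 := by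
  have key (y : Cm) (k : ℤ) : dC y (0, k + 1) = y (1, k) ∧ dC y (2, k) = y (1, k) + y (3, k - 2) ∧
      dC y (4, k) = y (3, k) := by
    induction y using Finsupp.induction_linear with
    | zero => simp
    | add f g hf hg => simp [hf, hg]; ring
    | single p c =>
      obtain ⟨l, m⟩ := p
      fin_cases l <;> simp [Finsupp.single_apply] <;> grind
  have hd (p : CBase) (hp : condA s p) : dC (inclS q x) p = 0 := by
    have := DFunLike.congr_fun hx ⟨p, (hq p).2 hp⟩
    simpa [endS_apply, projS_apply] using this
  set y := inclS q x with hy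
  have h1 (k : ℤ) (hk : k ≤ 2 - s) : y (1, k) = 0 := by
    rw [← (key y k).1]; exact hd _ (Or.inr (by simp; omega))
  have h3 (k : ℤ) (hk : condA s (3, k)) : y (3, k) = 0 := by
    rcases hk with hk | hk
    · rw [← (key y k).2.2]; exact hd _ (Or.inl hk)
    · simp at hk
      have := (key y (k + 2)).2.1
      rw [hd _ (Or.inr (by simp; omega)), h1 _ (by omega)] at this
      simpa using this.symm
  refine ⟨fun h => ?_, fun h => ?_⟩
  · rw [← inclS_apply, ← hy]
    rcases (hq _).1 h with hk | hk
    · have := (key y m).2.1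
      simp at hk
      rw [hd _ (Or.inl hk), h3 _ (Or.inl (by simp; omega))] at this
      simpa using this.symm
    · exact h1 _ (by simpa using hk)
  · rw [← inclS_apply, ← hy]
    exact h3 _ ((hq _).1 h)

lemma projS_mem_range (q : CBase → Prop) [DecidablePred q] (s : ℤ) (hq : ∀ p, q p ↔ condA s p)
    (x : Cm) : projS q (dC x) ∈ (endS q dC).range :=
  ⟨projS q x, endS_dC_projS q s hq x⟩

lemma projS_single_two_mem (q : CBase → Prop) [DecidablePred q] (s : ℤ)
    (hq : ∀ p, q p ↔ condA s p) (m c : ℤ) :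
    projS q (Finsupp.single (2, m) c) + projS q (Finsupp.single (0, m + 1) c) ∈
      (endS q dC).range := by
  simpa [add_comm] using projS_mem_range q s hq (Finsupp.single (1, m) c)

lemma projS_single_four_mem (q : CBase → Prop) [DecidablePred q] (s : ℤ)
    (hq : ∀ p, q p ↔ condA s p) (m c : ℤ) :
    projS q (Finsupp.single (4, m) c) - projS q (Finsupp.single (0, m + 3) c) ∈
      (endS q dC).range := by
  have h := projS_mem_range q s hq (Finsupp.single (3, m) c)
  have h' := projS_single_two_mem q s hq (m + 2) c
  convert sub_mem h h' using 1
  simp [add_assoc]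

lemma projS_single_zero_mem (q : CBase → Prop) [DecidablePred q] (s : ℤ)
    (hq : ∀ p, q p ↔ condA s p) (n c : ℤ) (hn : towerV s < n) :
    projS q (Finsupp.single (0, n) c) ∈ (endS q dC).range := by
  by_cases h0 : q (0, n)
  · have h2 := projS_single_two_mem q s hq (n - 1) c
    have h4 := projS_single_four_mem q s hq (n - 3) c
    rw [sub_add_cancel] at h2 h4
    by_cases h2' : q (2, n - 1)
    · have : ¬ q (4, n - 3) := by
        rw [hq] at h0 h2' ⊢
        unfold towerV at hn
        simp [condA] at *
        split_ifs at hn <;> omega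
      rw [projS_single_of_neg this] at h4
      simpa using h4
    · rw [projS_single_of_neg h2'] at h2
      simpa using h2
  · rw [projS_single_of_neg h0]; exact zero_mem _

/-- The inclusion of `ℤ[U, U⁻¹]` as the tower generated by `y_{1,n}`. -/
def towerC : (ℤ →₀ ℤ) →+ Cm :=
  Finsupp.liftAddHom fun n => Finsupp.singleAddHom ((0 : Fin 5), n)

@[simp] lemma towerC_single (n c : ℤ) :
    towerC (Finsupp.single n c) = Finsupp.single (0, n) c := by
  simp [towerC]

lemma sub_towerC_mem_range (q : CBase → Prop) [DecidablePred q] (s : ℤ)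
    (hq : ∀ p, q p ↔ condA s p) (x : SubC q) (hx : endS q dC x = 0) :
    x - projS q (towerC (psiC (inclS q x))) ∈ (endS q dC).range := by
  classical
  have hsum : x = x.sum Finsupp.single := (Finsupp.sum_single x).symm
  set f : SubC q →+ SubC q :=
    AddMonoidHom.id _ - (projS q).comp (towerC.comp (psiC.comp (inclS q))) with hf
  change f x ∈ _
  rw [hsum, Finsupp.sum, map_sum]
  refine sum_mem ?_
  rintro ⟨⟨l, m⟩, hp⟩ hmem
  rw [Finsupp.mem_support_iff] at hmem
  have hc := cycle_apply_eq_zero q s hq x hx m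
  generalize hcx : x ⟨(l, m), hp⟩ = c at hmem ⊢
  simp only [hf, AddMonoidHom.sub_apply, AddMonoidHom.id_apply, AddMonoidHom.comp_apply,
    inclS_single, psiC_single]
  rw [← projS_single_of_pos hp]
  fin_cases l
  · simp
  · exact absurd (hcx.symm.trans (hc.1 hp)) hmem
  · simpa using projS_single_two_mem q s hq m c
  · exact absurd (hcx.symm.trans (hc.2 hp)) hmem
  · simpa using projS_single_four_mem q s hq m c

lemma exact_of_psiC (q : CBase → Prop) [DecidablePred q] (s : ℤ)
    (hq : ∀ p, q p ↔ condA s p) (x : SubC q) (hx : endS q dC x = 0)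
    (hpsi : ∀ n ≤ towerV s, psiC (inclS q x) n = 0) : x ∈ (endS q dC).range := by
  have h := sub_towerC_mem_range q s hq x hx
  suffices h' : projS q (towerC (psiC (inclS q x))) ∈ (endS q dC).range by
    simpa using add_mem h h'
  set z := psiC (inclS q x)
  rw [← Finsupp.sum_single z, Finsupp.sum, map_sum, map_sum]
  refine sum_mem fun n hn => ?_
  rw [towerC_single]
  refine projS_single_zero_mem q s hq n _ ?_
  by_contra hle
  exact (Finsupp.mem_support_iff.1 hn) (hpsi n (not_lt.1 hle))

end Combinatorial

section MappingCone

lemma sumAddHom_single_comp_apply {M N : ℤ → Type*} [∀ s, AddCommGroup (M s)]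
    [∀ s, AddCommGroup (N s)] (f : ∀ s, M s →+ N s) (a : Π₀ s, M s) (s : ℤ) :
    DFinsupp.sumAddHom (fun t => (DFinsupp.singleAddHom N t).comp (f t)) a s = f s (a s) := by
  have : (DFinsupp.evalAddMonoidHom s).comp
      (DFinsupp.sumAddHom (fun t => (DFinsupp.singleAddHom N t).comp (f t))) =
      (f s).comp (DFinsupp.evalAddMonoidHom s) := by
    refine DFinsupp.addHom_ext fun t x => ?_
    simp only [AddMonoidHom.comp_apply, DFinsupp.sumAddHom_single,
      DFinsupp.singleAddHom_apply]
    change DFinsupp.single t (f t x) s = f s (DFinsupp.single t x s)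
    by_cases h : t = s
    · subst h; simp
    · simp [DFinsupp.single_eq_of_ne (Ne.symm h)]
  exact DFunLike.congr_fun this a

lemma dAS_apply (a : AS) (s : ℤ) : dAS a s = dA s (a s) :=
  sumAddHom_single_comp_apply (M := fun s => Am s) (N := fun s => Am s) (fun s => dA s) a s

lemma dBS_apply (b : BS) (s : ℤ) : dBS b s = dB (b s) :=
  sumAddHom_single_comp_apply (M := fun _ => Bm) (N := fun _ => Bm) (fun _ => dB) b s

lemma UAS_apply (a : AS) (s : ℤ) : UAS a s = UA s (a s) :=
  sumAddHom_single_comp_apply (M := fun s => Am s) (N := fun s => Am s) (fun s => UA s) a s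

lemma sgnAS_apply (a : AS) (s : ℤ) : sgnAS a s = sgnA s (a s) :=
  sumAddHom_single_comp_apply (M := fun s => Am s) (N := fun s => Am s) (fun s => sgnA s) a s

lemma Dp1_single (s : ℤ) (x : Am s) : Dp1 (DFinsupp.single s x) =
    DFinsupp.single s (vMap s x) + DFinsupp.single (s + 1) (hMap s x) := by
  simp [Dp1]

lemma Dp1_apply (a : AS) (s : ℤ) :
    Dp1 a s = vMap s (a s) + hMap (s - 1) (a (s - 1)) := by
  have : (DFinsupp.evalAddMonoidHom s).comp Dp1 =
      (vMap s).comp (DFinsupp.evalAddMonoidHom s) +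
      (hMap (s - 1)).comp (DFinsupp.evalAddMonoidHom (s - 1)) := by
    refine DFinsupp.addHom_ext fun t x => ?_
    simp only [AddMonoidHom.comp_apply, AddMonoidHom.add_apply, Dp1_single]
    change (DFinsupp.single t (vMap t x) : BS) s +
        (DFinsupp.single (t + 1) (hMap t x) : BS) s =
      vMap s (DFinsupp.single t x s) + hMap (s - 1) (DFinsupp.single t x (s - 1))
    by_cases h : t = s
    · subst h
      simp [DFinsupp.single_eq_of_ne (show t - 1 ≠ t by omega),
        DFinsupp.single_eq_of_ne (show t ≠ t + 1 by omega)]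
    · by_cases h' : t = s - 1
      · subst h'
        rw [DFinsupp.single_eq_of_ne (Ne.symm h), DFinsupp.single_eq_of_ne (Ne.symm h)]
        simp [DFinsupp.single_apply]
      · rw [DFinsupp.single_eq_of_ne (Ne.symm h), DFinsupp.single_eq_of_ne (Ne.symm h),
          DFinsupp.single_eq_of_ne (Ne.symm h'),
          DFinsupp.single_eq_of_ne (show s ≠ t + 1 by omega)]
        simp
  exact DFunLike.congr_fun this a

lemma dX1_fst (x : X1) : (dX1 x).1 = dAS x.1 := rfl

lemma dX1_snd (x : X1) : (dX1 x).2 = dBS x.2 + Dp1 (sgnAS x.1) := rfl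

lemma UX1_fst (x : X1) : (UX1 x).1 = UAS x.1 := rfl

lemma vMap_apply (s : ℤ) (a : Am s) : vMap s a = projS condB (inclS (condA s) a) := rfl

lemma hMap_apply (s : ℤ) (a : Am s) :
    hMap s a = projS condB (flipC (shiftC s (inclS (condA s) a))) := by
  refine hom_inclS_projS (condJ s) ((projS condB).comp
    (AddMonoidHom.comp flipC (shiftC s : Cm →+ Cm))) ?_ (inclS (condA s) a)
  rintro ⟨l, m⟩ c h
  change projS condB (flipC (shiftC s (Finsupp.single _ _))) = 0
  rw [shiftC_single, flipC_single, projS_single_of_neg]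
  simp [condB, condJ] at h ⊢
  omega

lemma vMap_projS (s : ℤ) (x : Cm) : vMap s (projS (condA s) x) = projS condB x := by
  refine hom_inclS_projS (condA s) (projS condB) ?_ x
  intro p c h
  exact projS_single_of_neg (fun h' => h (Or.inl h')) c

lemma hMap_projS (s : ℤ) (x : Cm) :
    hMap s (projS (condA s) x) = projS condB (flipC (shiftC s x)) := by
  rw [hMap_apply]
  refine hom_inclS_projS (condA s) ((projS condB).comp
    (AddMonoidHom.comp flipC (shiftC s : Cm →+ Cm))) ?_ x
  rintro ⟨l, m⟩ c h
  change projS condB (flipC (shiftC s (Finsupp.single _ _))) = 0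
  rw [shiftC_single, flipC_single, projS_single_of_neg]
  simp [condB, condA] at h ⊢
  omega

lemma dA_projS (s : ℤ) (x : Cm) : dA s (projS (condA s) x) = projS (condA s) (dC x) :=
  endS_dC_projS _ s (fun _ => Iff.rfl) x

lemma dB_projS (x : Cm) : dB (projS condB x) = projS condB (dC x) :=
  endS_dC_projS _ 3 condA_three x

lemma dC_flipC_shiftC (s : ℤ) (x : Cm) :
    dC (flipC (shiftC s x)) = flipC (shiftC s (dC x)) := by
  induction x using Finsupp.induction_linear with
  | zero => simp
  | add f g hf hg => simp [hf, hg]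
  | single p c =>
    obtain ⟨l, m⟩ := p
    fin_cases l
    · simp
    · simp [show (4 : Fin 5) - 1 = 3 from rfl, show (4 : Fin 5) - 2 = 2 from rfl]
      rw [add_comm]; congr 3 <;> ring
    · simp [show (4 : Fin 5) - 2 = 2 from rfl]
    · simp [show (4 : Fin 5) - 3 = 1 from rfl, show (4 : Fin 5) - 2 = 2 from rfl]
      rw [add_comm]; congr 3 <;> ring
    · simp

lemma sgnA_single (s : ℤ) (p : {p : CBase // condA s p}) (c : ℤ) :
    sgnA s (Finsupp.single p c) =
      Finsupp.single p ((if Even (grval p.1.1 - 2 * p.1.2) then (1 : ℤ) else -1) * c) :=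
  Finsupp.liftAddHom_apply_single _ p c

lemma sgnA_of_cycle (s : ℤ) (a : Am s) (ha : dA s a = 0) : sgnA s a = a := by
  have h := cycle_apply_eq_zero (condA s) s (fun _ => Iff.rfl) a ha
  conv_rhs => rw [← Finsupp.sum_single a]
  conv_lhs => rw [← Finsupp.sum_single a]
  rw [Finsupp.sum, map_sum]
  refine Finset.sum_congr rfl ?_
  rintro ⟨⟨l, m⟩, hp⟩ hmem
  rw [sgnA_single]
  rw [Finsupp.mem_support_iff] at hmem
  fin_cases l
  · simp [grval]
  · exact absurd ((h m).1 hp) hmem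
  · simp [grval, Int.even_sub]
  · exact absurd ((h m).2 hp) hmem
  · simp [grval, Int.even_sub, show Even (6 : ℤ) by decide]

lemma inclS_sgnA_dC (s : ℤ) (a : Am s) :
    dC (inclS (condA s) (sgnA s a)) = -dC (inclS (condA s) a) := by
  induction a using Finsupp.induction_linear with
  | zero => simp
  | add f g hf hg => simp [hf, hg, add_comm]
  | single p c =>
    obtain ⟨⟨l, m⟩, hp⟩ := p
    rw [sgnA_single]
    fin_cases l
    · simp
    · simp [grval, Int.even_sub, add_comm]
    · simp
    · simp [grval, Int.even_sub, show ¬ Even (5 : ℤ) by decide, add_comm]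
    · simp

lemma sgnAS_of_cycle (a : AS) (ha : dAS a = 0) : sgnAS a = a := by
  ext1 s
  rw [sgnAS_apply, sgnA_of_cycle]
  rw [← dAS_apply, ha]; rfl

lemma dBS_Dp1_sgnAS (a : AS) : dBS (Dp1 (sgnAS a)) = -Dp1 (dAS a) := by
  ext1 s
  rw [dBS_apply, DFinsupp.neg_apply, Dp1_apply, Dp1_apply, map_add, neg_add, sgnAS_apply,
    sgnAS_apply, dAS_apply, dAS_apply]
  congr 1
  · rw [vMap_apply, dB_projS, inclS_sgnA_dC, map_neg, ← vMap_projS s]; rfl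
  · rw [hMap_apply, dB_projS, dC_flipC_shiftC, inclS_sgnA_dC, map_neg, map_neg, map_neg,
      ← hMap_projS]; rfl

lemma mem_range_of_forall_apply {M N : ℤ → Type*} [∀ s, AddCommGroup (M s)]
    [∀ s, AddCommGroup (N s)] (f : ∀ s, M s →+ N s) (b : Π₀ s, N s)
    (h : ∀ s, b s ∈ (f s).range) : ∃ a : Π₀ s, M s, ∀ s, f s (a s) = b s := by
  classical
  choose g hg using h
  refine ⟨DFinsupp.mk b.support fun s => g s, fun s => ?_⟩
  by_cases hs : b s = 0
  · simp [hs]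
  · simp [hs, hg]

/-- The coefficients of the class of the `A⁺_s`-component of `x` in the tower `H_*(A⁺_s)`. -/
def coeffA (s n : ℤ) : X1 →+ ℤ :=
  (Finsupp.applyAddHom n).comp (psiC.comp ((inclS (condA s)).comp
    ((DFinsupp.evalAddMonoidHom s).comp (AddMonoidHom.fst AS BS))))

lemma coeffA_apply (s n : ℤ) (x : X1) : coeffA s n x = psiC (inclS (condA s) (x.1 s)) n := rfl

lemma coeffA_dX1 {s n : ℤ} (hn : n ≤ towerV s) (x : X1) : coeffA s n (dX1 x) = 0 := by
  rw [coeffA_apply, dX1_fst, dAS_apply]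
  refine (psiC_inclS_projS (condA s) s (fun _ => Iff.rfl) hn _).trans ?_
  exact DFunLike.congr_fun (psiC_dC _) n

lemma coeffA_UX1 {s n : ℤ} (hn : n ≤ towerV s) (x : X1) :
    coeffA s n (UX1 x) = coeffA s (n - 1) x := by
  rw [coeffA_apply, UX1_fst, UAS_apply]
  refine (psiC_inclS_projS (condA s) s (fun _ => Iff.rfl) hn _).trans ?_
  exact psiC_UC _ n

lemma psiC_inclS_projS_condB {n : ℤ} (hn : n ≤ 0) (x : Cm) :
    psiC (inclS condB (projS condB x)) n = psiC x n :=
  psiC_inclS_projS condB 3 condA_three hn x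

lemma coeffA_add_coeffA {x : X1} (hx : dX1 x = 0) (s : ℤ) {n : ℤ} (hn : n ≤ 0) :
    coeffA s n x + coeffA (s - 1) (n - (s - 1)) x = 0 := by
  have h1 : dAS x.1 = 0 := congrArg Prod.fst hx
  have h2 : dBS x.2 + Dp1 (sgnAS x.1) = 0 := congrArg Prod.snd hx
  rw [sgnAS_of_cycle _ h1] at h2
  have h3 := congrArg (fun b : BS => psiC (inclS condB (b s)) n) h2
  have h4 : psiC (inclS condB (dB (x.2 s))) n = 0 := by
    refine (psiC_inclS_projS_condB hn _).trans ?_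
    exact DFunLike.congr_fun (psiC_dC _) n
  simp only [DFinsupp.add_apply, dBS_apply, Dp1_apply, map_add, Finsupp.add_apply, h4,
    vMap_apply, hMap_apply, psiC_inclS_projS_condB hn, psiC_flipC_shiftC] at h3
  simpa [coeffA_apply] using h3

/-- The map on cycles of the mapping cone inducing the isomorphism on homology. -/
def phiX : X1 →+ W4 :=
  AddMonoidHom.mk' (fun x =>
    (Finsupp.comapDomain (fun j : ℕ => 1 - (j : ℤ)) (psiC (inclS (condA 0) (x.1 0)))
      (fun i _ j _ h => by simpa using h),
      ![coeffA 1 1 x + coeffA 0 1 x, coeffA 2 1 x + coeffA 1 0 x,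
        coeffA (-1) 2 x + coeffA 0 1 x, coeffA (-2) 3 x + coeffA (-1) 1 x])) (by
    intro x y
    refine Prod.ext ?_ ?_
    · ext j
      simp; rfl
    · ext i; fin_cases i <;> simp <;> ring)

lemma phiX_fst_apply (x : X1) (j : ℕ) : (phiX x).1 j = coeffA 0 (1 - j) x := rfl

lemma phiX_snd (x : X1) : (phiX x).2 =
    ![coeffA 1 1 x + coeffA 0 1 x, coeffA 2 1 x + coeffA 1 0 x,
      coeffA (-1) 2 x + coeffA 0 1 x, coeffA (-2) 3 x + coeffA (-1) 1 x] := rfl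

lemma UT_apply (t : TT) (j : ℕ) : UT t j = t (j + 1) := by
  induction t using Finsupp.induction_linear with
  | zero => simp
  | add f g hf hg => simp [hf, hg]
  | single i c =>
    have h : UT (Finsupp.single i c) =
        (if i = 0 then 0 else Finsupp.singleAddHom (i - 1) : ℤ →+ TT) c :=
      Finsupp.liftAddHom_apply_single _ i c
    rw [h]
    rcases i with _ | i
    · simp
    · simp [Finsupp.single_apply]

lemma phiX_dX1 (x : X1) : phiX (dX1 x) = 0 := by
  refine Prod.ext ?_ ?_
  · ext j
    rw [phiX_fst_apply, coeffA_dX1 (by simp [towerV])]; rfl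
  · rw [phiX_snd]
    repeat rw [coeffA_dX1 (by simp [towerV])]
    ext i; fin_cases i <;> rfl

lemma phiX_UX1 {x : X1} (hx : dX1 x = 0) : phiX (UX1 x) = UW4 (phiX x) := by
  refine Prod.ext ?_ ?_
  · change (phiX (UX1 x)).1 = UT (phiX x).1
    ext j
    rw [phiX_fst_apply, coeffA_UX1 (by simp [towerV]), UT_apply, phiX_fst_apply]
    congr 2
    push_cast; ring
  · change (phiX (UX1 x)).2 = 0
    rw [phiX_snd]
    repeat rw [coeffA_UX1 (by simp [towerV])]
    have h1 := coeffA_add_coeffA hx 1 (n := 0) le_rfl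
    have h2 := coeffA_add_coeffA hx 2 (n := 0) le_rfl
    have h3 := coeffA_add_coeffA hx 0 (n := 0) le_rfl
    have h4 := coeffA_add_coeffA hx (-1) (n := 0) le_rfl
    norm_num at h1 h2 h3 h4
    ext i
    fin_cases i <;> simp <;> linarith

lemma coeffA_eq_zero {x : X1} (hx : dX1 x = 0) (hphi : phiX x = 0) (s : ℤ) :
    ∀ n ≤ towerV s, coeffA s n x = 0 := by
  have h0 (n : ℤ) (hn : n ≤ 1) : coeffA 0 n x = 0 := by
    have := DFunLike.congr_fun (congrArg Prod.fst hphi) (1 - n).toNat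
    rw [phiX_fst_apply] at this
    rwa [show 1 - ((1 - n).toNat : ℤ) = n by omega] at this
  have hs (i : Fin 4) : (phiX x).2 i = 0 := by rw [hphi]; rfl
  rw [phiX_snd] at hs
  have k1 := hs 0
  have k2 := hs 1
  have k3 := hs 2
  have k4 := hs 3
  simp [h0] at k1 k2 k3 k4
  have hpos (k : ℕ) : ∀ n ≤ towerV k, coeffA k n x = 0 := by
    induction k with
    | zero => exact fun n hn => h0 n (by simpa [towerV] using hn)
    | succ k ih =>
      have hle (n : ℤ) (hn : n ≤ 0) : coeffA (k + 1 : ℕ) n x = 0 := by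
        have h := coeffA_add_coeffA hx (k + 1 : ℕ) hn
        push_cast at h ⊢
        rw [add_sub_cancel_right, ih _ (by unfold towerV; split_ifs <;> omega)] at h
        simpa using h
      intro n hn
      rcases le_or_gt n 0 with h | h
      · exact hle n h
      · obtain rfl : n = 1 := by unfold towerV at hn; split_ifs at hn <;> omega
        have hk : k = 0 ∨ k = 1 := by unfold towerV at hn; split_ifs at hn <;> omega
        rcases hk with rfl | rfl
        · simpa using k1
        · have := hle 0 le_rfl
          have := ih 0 (by simp [towerV])
          simp at this
          simpa [this] using k2
  have hneg (k : ℕ) : ∀ n ≤ towerV (-k), coeffA (-k) n x = 0 := by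
    induction k with
    | zero => exact fun n hn => h0 n (by simpa [towerV] using hn)
    | succ k ih =>
      have hle (n : ℤ) (hn : n ≤ k + 1) : coeffA (-(k + 1 : ℕ)) n x = 0 := by
        have h := coeffA_add_coeffA hx (-k) (n := n - (k + 1)) (by omega)
        rw [ih _ (by unfold towerV; split_ifs <;> omega)] at h
        push_cast
        rw [zero_add] at h
        convert h using 3 <;> ring
      intro n hn
      rcases le_or_gt n (k + 1) with h | h
      · exact hle n h
      · have hk : k = 0 ∨ k = 1 := by unfold towerV at hn; split_ifs at hn <;> omega
        rcases hk with rfl | rfl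
        · obtain rfl : n = 2 := by unfold towerV at hn; split_ifs at hn <;> omega
          simpa using k3
        · obtain rfl : n = 3 := by unfold towerV at hn; split_ifs at hn <;> omega
          have := ih 1 (by simp [towerV])
          simp at this
          simpa [this] using k4
  rcases Int.eq_nat_or_neg s with ⟨k, rfl | rfl⟩
  · exact hpos k
  · exact hneg k

/-- The elements of `⊕_s B⁺_s` that bound in the mapping cone an element whose `A⁺_0`-component
vanishes. -/
def boundB : AddSubgroup BS where
  carrier := {β | ∃ x : X1, x.1 0 = 0 ∧ dX1 x = (0, β)}
  zero_mem' := ⟨0, rfl, map_zero _⟩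
  add_mem' := by
    rintro _ _ ⟨x, hx, hx'⟩ ⟨y, hy, hy'⟩
    exact ⟨x + y, by simp [hx, hy], by rw [map_add, hx', hy']; simp⟩
  neg_mem' := by
    rintro _ ⟨x, hx, hx'⟩
    exact ⟨-x, by simp [hx], by rw [map_neg, hx']; simp⟩

lemma dBS_single (s : ℤ) (b : Bm) :
    dBS (DFinsupp.single s b) = DFinsupp.single s (dB b) := by
  ext1 t
  rw [dBS_apply]
  by_cases h : t = s
  · subst h; simp
  · rw [DFinsupp.single_eq_of_ne h, DFinsupp.single_eq_of_ne h, map_zero]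

lemma single_mem_boundB (s : ℤ) {b : Bm} (hb : b ∈ dB.range) :
    DFinsupp.single s b ∈ boundB := by
  obtain ⟨c, rfl⟩ := hb
  refine ⟨(0, DFinsupp.single s c), rfl, Prod.ext ?_ ?_⟩
  · rw [dX1_fst]; exact map_zero _
  · rw [dX1_snd, map_zero, map_zero, add_zero, dBS_single]; rfl

lemma exists_dX1_tower (s m c : ℤ) : ∃ b : BS,
    dX1 (DFinsupp.single s (projS (condA s) (Finsupp.single (0, m) c)), b) =
      (0, DFinsupp.single s (projS condB (Finsupp.single (0, m) c)) +
        DFinsupp.single (s + 1) (projS condB (Finsupp.single (0, m + s) c))) := by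
  set a : AS := DFinsupp.single s (projS (condA s) (Finsupp.single (0, m) c)) with ha
  have hd : dAS a = 0 := by
    ext1 t
    rw [dAS_apply, ha]
    by_cases h : t = s
    · subst h; simp [dA_projS]
    · rw [DFinsupp.single_eq_of_ne h, map_zero]; rfl
  obtain ⟨β, hβ⟩ := projS_single_four_mem condB 3 condA_three (m + s - 3) c
  rw [sub_add_cancel] at hβ
  change dB β = _ at hβ
  refine ⟨-DFinsupp.single (s + 1) β, Prod.ext hd ?_⟩
  rw [dX1_snd, sgnAS_of_cycle _ hd, map_neg, dBS_single, hβ, ha, Dp1_single, vMap_projS,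
    hMap_projS, shiftC_single, flipC_single]
  simp [DFinsupp.single_sub, add_comm]

lemma single_tower_mem_boundB (k : ℕ) : ∀ s n c : ℤ, 1 - n ≤ k →
    DFinsupp.single s (projS condB (Finsupp.single (0, n) c)) ∈ boundB := by
  induction k with
  | zero =>
    intro s n c hn
    rw [projS_single_of_neg (by simp [condB]; omega), DFinsupp.single_zero]
    exact zero_mem _
  | succ k ih =>
    intro s n c hn
    rcases lt_or_ge 0 s with hs | hs
    · obtain ⟨b, hb⟩ := exists_dX1_tower s n c
      have h := ih (s + 1) (n + s) c (by push_cast at hn; omega)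
      have h' : _ ∈ boundB := ⟨_, DFinsupp.single_eq_of_ne hs.ne, hb⟩
      simpa using sub_mem h' h
    · obtain ⟨b, hb⟩ := exists_dX1_tower (s - 1) (n - (s - 1)) c
      have h := ih (s - 1) (n - (s - 1)) c (by push_cast at hn; omega)
      have h' : _ ∈ boundB := ⟨_, DFinsupp.single_eq_of_ne (by omega), hb⟩
      simpa using sub_mem h' h

lemma single_mem_boundB_of_cycle (s : ℤ) {b : Bm} (hb : dB b = 0) :
    DFinsupp.single s b ∈ boundB := by
  have h := single_mem_boundB s (sub_towerC_mem_range condB 3 condA_three b hb)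
  suffices h' : DFinsupp.single s (projS condB (towerC (psiC (inclS condB b)))) ∈ boundB by
    simpa [DFinsupp.single_sub] using add_mem h h'
  set z := psiC (inclS condB b)
  change (DFinsupp.singleAddHom (fun _ : ℤ => Bm) s) _ ∈ boundB
  rw [← Finsupp.sum_single z, Finsupp.sum, map_sum, map_sum, map_sum]
  refine sum_mem fun n _ => ?_
  rw [towerC_single]
  exact single_tower_mem_boundB (1 - n).toNat s n _ (by omega)

lemma mem_boundB_of_cycle {β : BS} (hβ : dBS β = 0) : β ∈ boundB := by
  classical
  rw [← DFinsupp.sum_single (f := β)]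
  refine AddSubgroup.sum_mem _ fun s _ => single_mem_boundB_of_cycle s ?_
  rw [← dBS_apply, hβ]; rfl

lemma mem_range_of_phiX_eq_zero {x : X1} (hx : dX1 x = 0) (hphi : phiX x = 0) :
    x ∈ dX1.range := by
  have h1 : dAS x.1 = 0 := congrArg Prod.fst hx
  obtain ⟨a, ha⟩ : ∃ a : AS, ∀ s, dA s (a s) = x.1 s := by
    refine mem_range_of_forall_apply (M := fun s => Am s) (N := fun s => Am s)
      (fun s => dA s) x.1 fun s => ?_
    refine exact_of_psiC (condA s) s (fun _ => Iff.rfl) (x.1 s) ?_ (coeffA_eq_zero hx hphi s)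
    change dA s (x.1 s) = 0
    rw [← dAS_apply, h1]; rfl
  have ha' : dAS a = x.1 := by ext1 s; rw [dAS_apply, ha]
  have hb : dBS (x.2 - Dp1 (sgnAS a)) = 0 := by
    have h2 : dBS x.2 + Dp1 (sgnAS x.1) = 0 := congrArg Prod.snd hx
    rw [sgnAS_of_cycle _ h1] at h2
    rw [map_sub, dBS_Dp1_sgnAS, ha', sub_neg_eq_add, h2]
  obtain ⟨y, -, hy⟩ := mem_boundB_of_cycle hb
  refine ⟨(a, 0) + y, ?_⟩
  change dX1 ((a, 0) + y) = x
  rw [map_add, hy]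
  refine Prod.ext ?_ ?_
  · rw [Prod.fst_add, dX1_fst, ha', add_zero]
  · rw [Prod.snd_add, dX1_snd, map_zero]; simp

lemma coeffA_tower {s s' n : ℤ} (hn : n ≤ towerV s') (m c : ℤ) (b : BS) :
    coeffA s' n (DFinsupp.single s (projS (condA s) (Finsupp.single (0, m) c)), b) =
      if s' = s ∧ n = m then c else 0 := by
  rw [coeffA_apply]
  by_cases h : s' = s
  · subst h
    simp [psiC_inclS_projS (condA s') s' (fun _ => Iff.rfl) hn, Finsupp.single_apply, eq_comm]
  · simp [DFinsupp.single_eq_of_ne h, h]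

lemma exists_phiX_eq_reduced (i : Fin 4) (c : ℤ) :
    ∃ x, dX1 x = 0 ∧ phiX x = (0, Pi.single i c) := by
  obtain ⟨b, hb⟩ := exists_dX1_tower (![1, 2, -1, -2] i) (![1, 1, 2, 3] i) c
  refine ⟨_, hb.trans ?_, Prod.ext ?_ ?_⟩
  · rw [projS_single_of_neg, projS_single_of_neg] <;> fin_cases i <;> simp [condB]
  · ext j
    rw [phiX_fst_apply, coeffA_tower (by simp [towerV])]
    fin_cases i <;> simp
  · rw [phiX_snd]
    repeat rw [coeffA_tower (by simp [towerV])]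
    ext k
    fin_cases i <;> fin_cases k <;> simp

lemma exists_phiX_fst_eq (t : TT) : ∃ x, dX1 x = 0 ∧ (phiX x).1 = t := by
  induction t using Finsupp.induction_linear with
  | zero => exact ⟨0, map_zero _, by rw [map_zero]; rfl⟩
  | add f g hf hg =>
    obtain ⟨x, hx, hx'⟩ := hf
    obtain ⟨y, hy, hy'⟩ := hg
    exact ⟨x + y, by rw [map_add, hx, hy, add_zero], by rw [map_add, Prod.fst_add, hx', hy']⟩
  | single j c =>
    obtain ⟨b, hb⟩ := exists_dX1_tower 0 (1 - j) c
    obtain ⟨y, hy, hy'⟩ := add_mem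
      (single_tower_mem_boundB (1 - (1 - (j : ℤ))).toNat 0 (1 - j) c (by omega))
      (single_tower_mem_boundB (1 - (1 - (j : ℤ) + 0)).toNat (0 + 1) (1 - j + 0) c (by omega))
    refine ⟨_ - y, by rw [map_sub, hb, hy', sub_self], ?_⟩
    ext i
    rw [phiX_fst_apply, map_sub, coeffA_tower (by simp [towerV]), coeffA_apply _ _ y, hy]
    simp [Finsupp.single_apply, eq_comm]

lemma exists_phiX_eq (w : W4) : ∃ x, dX1 x = 0 ∧ phiX x = w := by
  obtain ⟨x, hx, hx'⟩ := exists_phiX_fst_eq w.1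
  choose y hy hy' using fun i => exists_phiX_eq_reduced i (w.2 i - (phiX x).2 i)
  refine ⟨x + ∑ i, y i, ?_, ?_⟩
  · rw [map_add, map_sum, hx]; simp [hy]
  · rw [map_add, map_sum]
    simp only [hy']
    refine Prod.ext ?_ ?_
    · simp [hx', Prod.fst_sum]
    · rw [Prod.snd_add, Prod.snd_sum, Finset.univ_sum_single]
      ext i; simp

end MappingCone

/-- For the torus knot `T_{3,4}`: the homology of the mapping cone `X⁺(1)` of
`D⁺₁ : ⊕_s A⁺_s → ⊕_s B⁺_s` is isomorphic, as a `ℤ[U]`-module, to `T ⊕ (ℤ[U]/U)⁴`.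
This computes `HF⁺` of `+1`-surgery on `T_{3,4}`, i.e. of `−Σ(3,4,11)`. -/
theorem stmt14 :
    ∃ e : Hq dX1 ≃+ W4,
      ∀ (x : X1) (hx : x ∈ cyc dX1) (hUx : UX1 x ∈ cyc dX1),
        e (hcl dX1 (UX1 x) hUx) = UW4 (e (hcl dX1 x hx)) := by
  have hker : (AddMonoidHom.range dX1).addSubgroupOf (cyc dX1) =
      (phiX.comp (cyc dX1).subtype).ker := by
    ext x
    rw [AddSubgroup.mem_addSubgroupOf, AddMonoidHom.mem_ker]
    refine ⟨?_, fun h => mem_range_of_phiX_eq_zero x.2 h⟩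
    rintro ⟨y, hy⟩
    change phiX x.1 = 0
    rw [← hy]
    exact phiX_dX1 y
  have hsurj : Function.Surjective (phiX.comp (cyc dX1).subtype) := by
    intro w
    obtain ⟨x, hx, hw⟩ := exists_phiX_eq w
    exact ⟨⟨x, hx⟩, hw⟩
  refine ⟨(QuotientAddGroup.quotientAddEquivOfEq hker).trans
    (QuotientAddGroup.quotientKerEquivOfSurjective _ hsurj), fun x hx _ => ?_⟩
  exact phiX_UX1 hx
end
end
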